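/- arXiv:2602.23189 — 7 statements merged into one kernel-verified Lean document; each statement's English description precedes it below -/
import Mathlib

section
/- Let γ > 0 and 0 < c̲ ≤ c̄ be real numbers. Then there exists a constant C > 0, depending only on γ, c̲ and c̄, such that for all real d₁ > 0 and d₂ ∈ [c̲, c̄], if a₁, a₂ ∈ (0,1) are the unique solutions of d₁·a₁^γ + a₁ − 1 = 0 and d₂·a₂^γ + a₂ − 1 = 0 respectively, then |a₁ − a₂| ≤ C·|d₁ − d₂|. -/
/-- If `x ≤ y` are roots in `(0,1)` of `c * x ^ γ + x - 1 = 0` and `d * y ^ γ + y - 1 = 0`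
with `0 ≤ d`, then `y - x ≤ |c - d|`. -/
theorem sub_le_abs_sub_of_roots {γ c d x y : ℝ} (hγ : 0 ≤ γ) (hd : 0 ≤ d)
    (hx : x ∈ Set.Ioo (0 : ℝ) 1) (hxy : x ≤ y)
    (hcx : c * x ^ γ + x - 1 = 0) (hdy : d * y ^ γ + y - 1 = 0) :
    y - x ≤ |c - d| := by
  have hpos : 0 ≤ x ^ γ := Real.rpow_nonneg hx.1.le γ
  have hle_one : x ^ γ ≤ 1 := Real.rpow_le_one hx.1.le hx.2.le hγ
  have hmono : d * x ^ γ ≤ d * y ^ γ :=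
    mul_le_mul_of_nonneg_left (Real.rpow_le_rpow hx.1.le hxy hγ) hd
  calc y - x ≤ (c - d) * x ^ γ := by linarith
    _ ≤ |c - d| * x ^ γ := mul_le_mul_of_nonneg_right (le_abs_self _) hpos
    _ ≤ |c - d| := mul_le_of_le_one_right (abs_nonneg _) hle_one

/-- Lipschitz-type estimate for the root of `d * x ^ γ + x - 1 = 0` in `(0,1)`:
for `d₂` in a fixed compact `[c̲, c̄] ⊂ (0, ∞)` and arbitrary `d₁ > 0`, the roots satisfy
`|a₁ - a₂| ≤ C * |d₁ - d₂|` with `C` depending only on `γ, c̲, c̄`. -/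
theorem root_lipschitz (γ cmin cmax : ℝ) (hγ : 0 < γ) (hcmin : 0 < cmin) (hc : cmin ≤ cmax) :
    ∃ C > 0, ∀ d₁ d₂ a₁ a₂ : ℝ, 0 < d₁ → d₂ ∈ Set.Icc cmin cmax →
      a₁ ∈ Set.Ioo (0 : ℝ) 1 → a₂ ∈ Set.Ioo (0 : ℝ) 1 →
      d₁ * a₁ ^ γ + a₁ - 1 = 0 → d₂ * a₂ ^ γ + a₂ - 1 = 0 →
      |a₁ - a₂| ≤ C * |d₁ - d₂| := by
  refine ⟨1, one_pos, fun d₁ d₂ a₁ a₂ hd₁ hd₂ ha₁ ha₂ h₁ h₂ => ?_⟩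
  rw [one_mul, abs_le']
  rcases le_total a₁ a₂ with h | h
  · have := sub_le_abs_sub_of_roots hγ.le (hcmin.le.trans hd₂.1) ha₁ h h₁ h₂
    constructor <;> linarith [abs_nonneg (d₁ - d₂)]
  · have := sub_le_abs_sub_of_roots hγ.le hd₁.le ha₂ h h₂ h₁
    rw [abs_sub_comm] at this
    constructor <;> linarith [abs_nonneg (d₁ - d₂)]
end

section
/- Let γ > 0, c > 0, M > 0 and 0 < c̲ ≤ c̄ be real numbers. Then there exists a constant C > 0, depending only on γ, c, M, c̲, c̄, such that the following holds. Let R₊, R₋, R₊ᵉ, R₋ᵉ be real numbers with R₊ ≥ c, R₊ᵉ ≥ c, 0 ≤ R₋ ≤ M, R₋ᵉ ≥ 0, and such that d₂ := R₋/R₊^γ ∈ [c̲, c̄]. Let α, αᵉ ∈ (0,1) be the unique solutions of (R₋/R₊^γ)·α^γ + α − 1 = 0 and (R₋ᵉ/(R₊ᵉ)^γ)·(αᵉ)^γ + αᵉ − 1 = 0 respectively. Then |αᵉ − α| ≤ C·(|R₊ᵉ − R₊| + |R₋ᵉ − R₋|). -/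
/-- On `[c, ∞)` with `c > 0`, the function `x ↦ x ^ (-γ)` is Lipschitz with constant
`γ * c ^ (-γ - 1)`. -/
theorem abs_rpow_neg_sub_rpow_neg_le {γ c x y : ℝ} (hγ : 0 ≤ γ) (hc : 0 < c)
    (hx : c ≤ x) (hy : c ≤ y) :
    |y ^ (-γ) - x ^ (-γ)| ≤ γ * c ^ (-γ - 1) * |y - x| := by
  have hderiv : ∀ z ∈ Set.Ici c,
      HasDerivWithinAt (fun t : ℝ => t ^ (-γ)) (-γ * z ^ (-γ - 1)) (Set.Ici c) z := fun z hz =>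
    (Real.hasDerivAt_rpow_const (Or.inl (hc.trans_le hz).ne')).hasDerivWithinAt
  have hbound : ∀ z ∈ Set.Ici c, ‖-γ * z ^ (-γ - 1)‖ ≤ γ * c ^ (-γ - 1) := by
    intro z hz
    have hz0 : 0 < z := hc.trans_le hz
    rw [Real.norm_eq_abs, abs_mul, abs_neg, abs_of_nonneg hγ,
      abs_of_pos (Real.rpow_pos_of_pos hz0 _)]
    exact mul_le_mul_of_nonneg_left
      (Real.rpow_le_rpow_of_nonpos hc hz (by linarith)) hγ
  exact (convex_Ici c).norm_image_sub_le_of_norm_hasDerivWithin_le hderiv hbound hx hy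

/-- The root in `(0, 1)` of `d * x ^ γ + x - 1` is a `1`-Lipschitz function of `d`. -/
theorem abs_sub_le_of_closure_roots {γ d e x y : ℝ} (hγ : 0 ≤ γ) (hd : 0 ≤ d)
    (hx : x ∈ Set.Ioo (0 : ℝ) 1) (hy : y ∈ Set.Ioo (0 : ℝ) 1)
    (hdx : d * x ^ γ + x - 1 = 0) (hey : e * y ^ γ + y - 1 = 0) :
    |y - x| ≤ |d - e| := by
  have hy0 : 0 ≤ y ^ γ := Real.rpow_nonneg hy.1.le _
  have hy1 : y ^ γ ≤ 1 := Real.rpow_le_one hy.1.le hy.2.le hγ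
  have hprod : |(d - e) * y ^ γ| ≤ |d - e| := by
    rw [abs_mul, abs_of_nonneg hy0]
    exact mul_le_of_le_one_right (abs_nonneg _) hy1
  refine le_trans ?_ hprod
  rcases le_total x y with h | h
  · have hmono := mul_le_mul_of_nonneg_left (Real.rpow_le_rpow hx.1.le h hγ) hd
    rw [abs_of_nonneg (sub_nonneg.2 h)]
    exact le_trans (by linarith) (le_abs_self _)
  · have hmono := mul_le_mul_of_nonneg_left (Real.rpow_le_rpow hy.1.le h hγ) hd
    rw [abs_of_nonpos (sub_nonpos.2 h)]
    exact le_trans (by linarith) (neg_le_abs _)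

/-- Control of the volume fraction by the partial masses (Lemma `lemma_alpha`):
if `R₊, R₊ᵉ ≥ c > 0`, `0 ≤ R₋ ≤ M`, `R₋ᵉ ≥ 0` and `d₂ = R₋ / R₊ ^ γ ∈ [c̲, c̄]`,
and `α, αᵉ ∈ (0,1)` are the roots of the corresponding closure equations, then
`|αᵉ - α| ≤ C * (|R₊ᵉ - R₊| + |R₋ᵉ - R₋|)` with `C` depending only on `γ, c, M, c̲, c̄`. -/
theorem volume_fraction_control (γ c M cmin cmax : ℝ) (hγ : 0 < γ) (hc : 0 < c) (hM : 0 < M)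
    (hcmin : 0 < cmin) (hcc : cmin ≤ cmax) :
    ∃ C > 0, ∀ Rp Rm Rpe Rme α αe : ℝ,
      c ≤ Rp → c ≤ Rpe → 0 ≤ Rm → Rm ≤ M → 0 ≤ Rme →
      Rm / Rp ^ γ ∈ Set.Icc cmin cmax →
      α ∈ Set.Ioo (0 : ℝ) 1 → αe ∈ Set.Ioo (0 : ℝ) 1 →
      (Rm / Rp ^ γ) * α ^ γ + α - 1 = 0 →
      (Rme / Rpe ^ γ) * αe ^ γ + αe - 1 = 0 →
      |αe - α| ≤ C * (|Rpe - Rp| + |Rme - Rm|) := by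
  have hK : 0 < c ^ (-γ) := Real.rpow_pos_of_pos hc _
  have hL : 0 < M * (γ * c ^ (-γ - 1)) :=
    mul_pos hM (mul_pos hγ (Real.rpow_pos_of_pos hc _))
  refine ⟨c ^ (-γ) + M * (γ * c ^ (-γ - 1)), add_pos hK hL, ?_⟩
  intro Rp Rm Rpe Rme α αe hRp hRpe hRm hRmM _ hd hα hαe hroot hroote
  have hRpe0 : 0 < Rpe := hc.trans_le hRpe
  refine (abs_sub_le_of_closure_roots hγ.le (hcmin.le.trans hd.1) hα hαe hroot hroote).trans ?_
  have hsplit : Rm / Rp ^ γ - Rme / Rpe ^ γ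
      = -((Rme - Rm) * Rpe ^ (-γ)) - Rm * (Rpe ^ (-γ) - Rp ^ (-γ)) := by
    rw [Real.rpow_neg hRpe0.le, Real.rpow_neg (hc.trans_le hRp).le]
    ring
  have hmass : |(Rme - Rm) * Rpe ^ (-γ)| ≤ c ^ (-γ) * |Rme - Rm| := by
    rw [abs_mul, abs_of_pos (Real.rpow_pos_of_pos hRpe0 _), mul_comm]
    exact mul_le_mul_of_nonneg_right
      (Real.rpow_le_rpow_of_nonpos hc hRpe (by linarith)) (abs_nonneg _)
  have hpow : |Rm * (Rpe ^ (-γ) - Rp ^ (-γ))| ≤ M * (γ * c ^ (-γ - 1)) * |Rpe - Rp| := by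
    rw [abs_mul, abs_of_nonneg hRm, mul_assoc]
    exact mul_le_mul hRmM (abs_rpow_neg_sub_rpow_neg_le hγ.le hc hRp hRpe) (abs_nonneg _) hM.le
  have htri := abs_sub (-((Rme - Rm) * Rpe ^ (-γ))) (Rm * (Rpe ^ (-γ) - Rp ^ (-γ)))
  rw [abs_neg] at htri
  rw [hsplit]
  have h1 := mul_nonneg hK.le (abs_nonneg (Rpe - Rp))
  have h2 := mul_nonneg hL.le (abs_nonneg (Rme - Rm))
  linarith
end

section
/- Let (Ω, μ) be a measure space and let f, g : Ω → ℝ be integrable functions with f ≥ 0 a.e., g > 0 a.e., ∫ f dμ = ∫ g dμ, and such that the function f·ln₊(f/g) is integrable, where ln₊ s := max(0, ln s). Then ∫ |f − g| dμ ≤ 2·∫ f·ln₊(f/g) dμ. -/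
open MeasureTheory

/-- Pointwise form of the inequality, from `1 - b / a ≤ log (a / b)`. -/
theorem abs_sub_le_two_mul_mul_posLog_sub {a b : ℝ} (ha : 0 ≤ a) (hb : 0 < b) :
    |a - b| ≤ 2 * (a * max 0 (Real.log (a / b))) - (a - b) := by
  rcases le_or_gt a b with h | h
  · rw [abs_of_nonpos (by linarith)]
    have : 0 ≤ a * max 0 (Real.log (a / b)) := mul_nonneg ha (le_max_left _ _)
    linarith
  · have ha' : 0 < a := hb.trans h
    have hlog : 1 - (a / b)⁻¹ ≤ max 0 (Real.log (a / b)) :=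
      (Real.one_sub_inv_le_log_of_pos (div_pos ha' hb)).trans (le_max_right _ _)
    have hmul := mul_le_mul_of_nonneg_left hlog ha
    have hsub : a * (1 - (a / b)⁻¹) = a - b := by field_simp
    rw [abs_of_pos (by linarith)]
    linarith

/-- Csiszár–Kullback–Pinsker-type inequality: if `f ≥ 0` a.e., `g > 0` a.e.,
`∫ f = ∫ g` and `f * ln₊(f/g)` is integrable (`ln₊ s = max 0 (ln s)`), then
`∫ |f - g| ≤ 2 ∫ f * ln₊(f/g)`. -/
theorem L1_le_two_mul_relative_entropy
    {Ω : Type*} [MeasurableSpace Ω] (μ : Measure Ω) (f g : Ω → ℝ)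
    (hf : Integrable f μ) (hg : Integrable g μ)
    (hf0 : ∀ᵐ x ∂μ, 0 ≤ f x) (hg0 : ∀ᵐ x ∂μ, 0 < g x)
    (heq : ∫ x, f x ∂μ = ∫ x, g x ∂μ)
    (hint : Integrable (fun x => f x * max 0 (Real.log (f x / g x))) μ) :
    ∫ x, |f x - g x| ∂μ ≤ 2 * ∫ x, f x * max 0 (Real.log (f x / g x)) ∂μ := by
  have hfg : Integrable (fun x => f x - g x) μ := hf.sub hg
  calc ∫ x, |f x - g x| ∂μ
      ≤ ∫ x, (2 * (f x * max 0 (Real.log (f x / g x))) - (f x - g x)) ∂μ := by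
        refine integral_mono_ae hfg.abs ((hint.const_mul 2).sub hfg) ?_
        filter_upwards [hf0, hg0] with x hfx hgx
        exact abs_sub_le_two_mul_mul_posLog_sub hfx hgx
    _ = 2 * ∫ x, f x * max 0 (Real.log (f x / g x)) ∂μ := by
        rw [integral_sub (hint.const_mul 2) hfg, integral_sub hf hg, heq, sub_self,
          sub_zero, integral_const_mul]
end

section
/- Let (Ω, μ) be a measure space and let f, g : Ω → ℝ be integrable functions with f ≥ 0 a.e. and g > 0 a.e. Then 0 ≤ ∫_{{x : 0 < f(x) ≤ g(x)}} f·ln(g/f) dμ ≤ ∫ |f − g| dμ. In particular, the function f·ln(g/f) is integrable on the set {0 < f ≤ g}. -/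
open MeasureTheory

/-- For `0 < a`, the tangent line bound `log t ≤ t - 1` gives `a * log (b / a) ≤ b - a`. -/
theorem mul_log_div_le_sub {a b : ℝ} (ha : 0 < a) (hb : 0 < b) :
    a * Real.log (b / a) ≤ b - a := by
  calc a * Real.log (b / a) ≤ a * (b / a - 1) :=
        mul_le_mul_of_nonneg_left (Real.log_le_sub_one_of_pos (div_pos hb ha)) ha.le
    _ = b - a := by field_simp

/-- If `f ≥ 0` a.e. and `g > 0` a.e. are integrable, then `f * ln(g/f)` is integrable
on the set `{0 < f ≤ g}` and
`0 ≤ ∫_{0 < f ≤ g} f * ln(g/f) ≤ ∫ |f - g|`. -/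
theorem integral_f_log_div_on_le
    {Ω : Type*} [MeasurableSpace Ω] (μ : Measure Ω) (f g : Ω → ℝ)
    (hf : Integrable f μ) (hg : Integrable g μ)
    (hf0 : ∀ᵐ x ∂μ, 0 ≤ f x) (hg0 : ∀ᵐ x ∂μ, 0 < g x) :
    IntegrableOn (fun x => f x * Real.log (g x / f x)) {x | 0 < f x ∧ f x ≤ g x} μ ∧
    0 ≤ ∫ x in {x | 0 < f x ∧ f x ≤ g x}, f x * Real.log (g x / f x) ∂μ ∧
    ∫ x in {x | 0 < f x ∧ f x ≤ g x}, f x * Real.log (g x / f x) ∂μ ≤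
      ∫ x, |f x - g x| ∂μ := by
  have hs : NullMeasurableSet {x | 0 < f x ∧ f x ≤ g x} μ :=
    (nullMeasurableSet_lt aemeasurable_const hf.aemeasurable).inter
      (nullMeasurableSet_le hf.aemeasurable hg.aemeasurable)
  have h_nonneg : ∀ᵐ x ∂μ.restrict {x | 0 < f x ∧ f x ≤ g x},
      0 ≤ f x * Real.log (g x / f x) := by
    filter_upwards [ae_restrict_mem₀ hs] with x hx
    exact mul_nonneg hx.1.le (Real.log_nonneg ((one_le_div hx.1).2 hx.2))
  have h_le : ∀ᵐ x ∂μ.restrict {x | 0 < f x ∧ f x ≤ g x},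
      f x * Real.log (g x / f x) ≤ |f x - g x| := by
    filter_upwards [ae_restrict_mem₀ hs] with x hx
    rw [abs_sub_comm]
    exact (mul_log_div_le_sub hx.1 (hx.1.trans_le hx.2)).trans (le_abs_self _)
  have h_abs : Integrable (fun x => |f x - g x|) μ := (hf.sub hg).abs
  have h_int : IntegrableOn (fun x => f x * Real.log (g x / f x))
      {x | 0 < f x ∧ f x ≤ g x} μ := by
    refine h_abs.integrableOn.mono' ?_ ?_
    · exact (hf.aemeasurable.mul
        (hg.aemeasurable.div hf.aemeasurable).log).aestronglyMeasurable.restrict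
    · filter_upwards [h_nonneg, h_le] with x h₀ h₁
      rwa [Real.norm_of_nonneg h₀]
  exact ⟨h_int, integral_nonneg_of_ae h_nonneg,
    (integral_mono_ae h_int h_abs.integrableOn h_le).trans
      (setIntegral_le_integral h_abs (ae_of_all _ fun x => abs_nonneg _))⟩
end

section
/- Let (Ω, μ) be a measure space and let f, g : Ω → ℝ be integrable functions with f ≥ 0 a.e., g > 0 a.e., ∫ f dμ = ∫ g dμ, and such that the function f·ln₊(f/g) is integrable, where ln₊ s := max(0, ln s). Then ∫ f·|ln(f/g)| dμ ≤ 3·∫ f·ln₊(f/g) dμ, where f·|ln(f/g)| is interpreted as 0 at points where f = 0. -/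
open MeasureTheory

/-- Pointwise bound: integrating it kills the term `b - a` when the masses agree. -/
theorem mul_abs_log_div_le {a b : ℝ} (ha : 0 ≤ a) (hb : 0 < b) :
    a * |Real.log (a / b)| ≤ 2 * (a * max 0 (Real.log (a / b))) + (b - a) := by
  rcases ha.eq_or_lt with rfl | ha
  · simpa using hb.le
  have key : a - b ≤ a * Real.log (a / b) := by
    have h := mul_le_mul_of_nonneg_left (Real.one_sub_inv_le_log_of_pos (div_pos ha hb)) ha.le
    have e : a * (1 - (a / b)⁻¹) = a - b := by field_simp
    linarith
  rcases le_total 0 (Real.log (a / b)) with h | h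
  · rw [abs_of_nonneg h, max_eq_right h]
    linarith
  · rw [abs_of_nonpos h, max_eq_left h]
    linarith

/-- If `f ≥ 0` a.e., `g > 0` a.e., `∫ f = ∫ g` and `f * ln₊(f/g)` is integrable
(`ln₊ s = max 0 (ln s)`), then `∫ f * |ln(f/g)| ≤ 3 ∫ f * ln₊(f/g)`.
(At points where `f = 0` both integrands vanish.) -/
theorem integral_f_abs_log_le_three_mul_relative_entropy
    {Ω : Type*} [MeasurableSpace Ω] (μ : Measure Ω) (f g : Ω → ℝ)
    (hf : Integrable f μ) (hg : Integrable g μ)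
    (hf0 : ∀ᵐ x ∂μ, 0 ≤ f x) (hg0 : ∀ᵐ x ∂μ, 0 < g x)
    (heq : ∫ x, f x ∂μ = ∫ x, g x ∂μ)
    (hint : Integrable (fun x => f x * max 0 (Real.log (f x / g x))) μ) :
    ∫ x, f x * |Real.log (f x / g x)| ∂μ ≤
      3 * ∫ x, f x * max 0 (Real.log (f x / g x)) ∂μ := by
  have hpos : 0 ≤ ∫ x, f x * max 0 (Real.log (f x / g x)) ∂μ :=
    integral_nonneg_of_ae (by
      filter_upwards [hf0] with x hx using mul_nonneg hx (le_max_left _ _))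
  calc ∫ x, f x * |Real.log (f x / g x)| ∂μ
      ≤ ∫ x, (2 * (f x * max 0 (Real.log (f x / g x))) + (g x - f x)) ∂μ := by
        refine integral_mono_of_nonneg ?_ ((hint.const_mul 2).add (hg.sub hf)) ?_
        · filter_upwards [hf0] with x hx using mul_nonneg hx (abs_nonneg _)
        · filter_upwards [hf0, hg0] with x hx hx' using mul_abs_log_div_le hx hx'
    _ = 2 * ∫ x, f x * max 0 (Real.log (f x / g x)) ∂μ := by
        have hsub : Integrable (fun x => g x - f x) μ := hg.sub hf
        rw [integral_add (hint.const_mul 2) hsub, integral_sub hg hf,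
          integral_const_mul, heq, sub_self, add_zero]
    _ ≤ 3 * ∫ x, f x * max 0 (Real.log (f x / g x)) ∂μ := by linarith
end

section
/- Let γ > 1 and 0 < k₁ ≤ k₂ be real numbers. Then there exist constants c₁, c₂ > 0 such that for all real ρ ≥ 0 and all r ∈ [k₁, k₂]: if |ρ − r| < 1 then c₁·|ρ − r|² ≤ H_γ(ρ | r) ≤ c₂·|ρ − r|², and if |ρ − r| ≥ 1 then c₁·|ρ − r|^γ ≤ H_γ(ρ | r) ≤ c₂·|ρ − r|^γ. -/
/-- Relative internal energy (Bregman divergence of `ρ ↦ ρ^γ/(γ-1)`):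
`H_γ(ρ | r) = (ρ^γ - r^γ - γ r^(γ-1) (ρ - r)) / (γ - 1)`, with real powers. -/
noncomputable def Hrel (γ ρ r : ℝ) : ℝ :=
  (ρ ^ γ - r ^ γ - γ * r ^ (γ - 1) * (ρ - r)) / (γ - 1)

open Filter Topology Set

theorem IsCompact.exists_pos_bounds {K : Set ℝ} {f : ℝ → ℝ} (hK : IsCompact K)
    (hf : ContinuousOn f K) (hpos : ∀ x ∈ K, 0 < f x) :
    ∃ a > 0, ∃ b > 0, ∀ x ∈ K, a ≤ f x ∧ f x ≤ b := by
  rcases K.eq_empty_or_nonempty with rfl | hne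
  · exact ⟨1, one_pos, 1, one_pos, by simp⟩
  obtain ⟨x, hx, hmin⟩ := hK.exists_isMinOn hne hf
  obtain ⟨y, hy, hmax⟩ := hK.exists_isMaxOn hne hf
  exact ⟨f x, hpos x hx, f y, hpos y hy, fun z hz => ⟨hmin hz, hmax hz⟩⟩

theorem Hrel_one_add_pos {γ t : ℝ} (hγ : 1 < γ) (ht : -1 ≤ t) (ht0 : t ≠ 0) :
    0 < Hrel γ (1 + t) 1 := by
  have := one_add_mul_self_lt_rpow_one_add ht ht0 hγ
  apply div_pos _ (by linarith)
  simp only [Real.one_rpow]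
  linarith

theorem continuous_Hrel_one_add {γ : ℝ} (hγ : 1 < γ) :
    Continuous fun t => Hrel γ (1 + t) 1 := by
  unfold Hrel
  have : Continuous fun t : ℝ => (1 + t) ^ γ :=
    (Real.continuous_rpow_const (by linarith)).comp (by fun_prop)
  fun_prop

theorem Hrel_eq_rpow_mul {γ ρ r : ℝ} (hρ : 0 ≤ ρ) (hr : 0 < r) :
    Hrel γ ρ r = r ^ γ * Hrel γ (1 + (ρ - r) / r) 1 := by
  have h1 : 1 + (ρ - r) / r = ρ / r := by field_simp; ring
  have hrγ : r ^ γ ≠ 0 := (Real.rpow_pos_of_pos hr γ).ne'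
  rw [h1]
  unfold Hrel
  rw [Real.div_rpow hρ hr.le, Real.rpow_sub_one hr.ne', Real.one_rpow, Real.one_rpow,
    mul_div_assoc']
  field_simp

theorem tendsto_Hrel_one_add_div_sq {γ : ℝ} (hγ : 1 < γ) :
    Tendsto (fun t => Hrel γ (1 + t) 1 / t ^ 2) (𝓝[≠] 0) (𝓝 (γ / 2)) := by
  have hγ1 : γ - 1 ≠ 0 := by linarith
  have hd (p t : ℝ) (ht : -1 < t) :
      HasDerivAt (fun t : ℝ => (1 + t) ^ p) (p * (1 + t) ^ (p - 1)) t := by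
    have := ((hasDerivAt_id t).const_add 1).rpow_const (p := p) (Or.inl (by simp; linarith))
    simpa using this
  have hnear : ∀ᶠ t : ℝ in 𝓝[≠] 0, -1 < t :=
    eventually_nhdsWithin_of_eventually_nhds (lt_mem_nhds (by norm_num))
  refine HasDerivAt.lhopital_zero_nhdsNE
    (f' := fun t => (γ * (1 + t) ^ (γ - 1) - γ) / (γ - 1)) (g' := fun t => 2 * t)
    ?_ ?_ ?_ ?_ ?_ ?_
  · filter_upwards [hnear] with t ht
    unfold Hrel
    have := (((hd γ t ht).sub_const 1).sub ((hasDerivAt_id t).const_mul γ)).div_const (γ - 1)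
    simpa using this
  · exact Eventually.of_forall fun t => by simpa using hasDerivAt_pow 2 t
  · filter_upwards [self_mem_nhdsWithin] with t ht
    exact mul_ne_zero two_ne_zero ht
  · have := (continuous_Hrel_one_add hγ).tendsto 0
    simp only [Hrel] at this ⊢
    simpa using this.mono_left nhdsWithin_le_nhds
  · have := (continuous_pow (M := ℝ) 2).tendsto 0
    simpa using this.mono_left nhdsWithin_le_nhds
  · have h := hasDerivAt_iff_tendsto_slope.mp (hd (γ - 1) 0 (by norm_num))
    have h2 := h.const_mul (γ / (2 * (γ - 1)))
    have e : γ / (2 * (γ - 1)) * ((γ - 1) * (1 + 0) ^ (γ - 1 - 1)) = γ / 2 := by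
      simp; field_simp
    rw [e] at h2
    refine h2.congr' ?_
    filter_upwards [self_mem_nhdsWithin] with t ht
    have ht : t ≠ 0 := ht
    simp only [slope_def_field, add_zero, Real.one_rpow, sub_zero]
    field_simp

theorem tendsto_Hrel_one_add_div_rpow {γ : ℝ} (hγ : 1 < γ) :
    Tendsto (fun t => Hrel γ (1 + t) 1 / |t| ^ γ) atTop (𝓝 (1 / (γ - 1))) := by
  have h1 : Tendsto (fun t : ℝ => (t⁻¹ + 1) ^ γ) atTop (𝓝 1) := by
    simpa using (tendsto_inv_atTop_zero.add_const (1 : ℝ)).rpow_const (p := γ) (by simp)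
  have h2 : Tendsto (fun t : ℝ => t ^ (-γ)) atTop (𝓝 0) :=
    tendsto_rpow_neg_atTop (by linarith)
  have h3 : Tendsto (fun t : ℝ => γ * t ^ (-(γ - 1))) atTop (𝓝 0) := by
    simpa using (tendsto_rpow_neg_atTop (y := γ - 1) (by linarith)).const_mul γ
  have h := ((h1.sub h2).sub h3).div_const (γ - 1)
  simp only [sub_zero] at h
  refine h.congr' ?_
  filter_upwards [eventually_gt_atTop 0] with t ht
  have e : t⁻¹ + 1 = (1 + t) / t := by field_simp
  have htγ : t ^ γ ≠ 0 := (Real.rpow_pos_of_pos ht γ).ne'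
  rw [e, Real.div_rpow (by linarith) ht.le, abs_of_pos ht, Real.rpow_neg ht.le, Real.rpow_neg ht.le,
    Real.rpow_sub_one ht.ne', Hrel, div_right_comm]
  simp only [Real.one_rpow]
  congr 1
  field_simp
  ring

theorem Hrel_one_add_sq_bounds {γ : ℝ} (hγ : 1 < γ) (R : ℝ) :
    ∃ a > 0, ∃ b > 0, ∀ t ∈ Icc (-1) R,
      a * t ^ 2 ≤ Hrel γ (1 + t) 1 ∧ Hrel γ (1 + t) 1 ≤ b * t ^ 2 := by
  have hc : Continuous (Function.update (fun t => Hrel γ (1 + t) 1 / t ^ 2) 0 (γ / 2)) := by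
    rw [continuous_iff_continuousAt]
    intro t
    rcases eq_or_ne t 0 with rfl | ht
    · exact continuousAt_update_same.mpr (tendsto_Hrel_one_add_div_sq hγ)
    · rw [continuousAt_update_of_ne ht]
      exact (continuous_Hrel_one_add hγ).continuousAt.div (by fun_prop) (pow_ne_zero 2 ht)
  obtain ⟨a, ha, b, hb, hab⟩ := (isCompact_Icc (a := -1) (b := R)).exists_pos_bounds
    hc.continuousOn (fun t ht => by
      rcases eq_or_ne t 0 with rfl | ht0
      · simp only [Function.update_self]; linarith
      · rw [Function.update_of_ne ht0]
        exact div_pos (Hrel_one_add_pos hγ ht.1 ht0) (by positivity))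
  refine ⟨a, ha, b, hb, fun t ht => ?_⟩
  rcases eq_or_ne t 0 with rfl | ht0
  · simp [Hrel]
  · have := hab t ht
    rwa [Function.update_of_ne ht0, le_div_iff₀ (by positivity), div_le_iff₀ (by positivity)]
      at this

theorem Hrel_one_add_rpow_bounds {γ δ : ℝ} (hγ : 1 < γ) (hδ : 0 < δ) :
    ∃ a > 0, ∃ b > 0, ∀ t, -1 ≤ t → δ ≤ |t| →
      a * |t| ^ γ ≤ Hrel γ (1 + t) 1 ∧ Hrel γ (1 + t) 1 ≤ b * |t| ^ γ := by
  have hl : 0 < 1 / (γ - 1) := one_div_pos.mpr (by linarith)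
  obtain ⟨A, hA⟩ := eventually_atTop.mp ((tendsto_Hrel_one_add_div_rpow hγ).eventually
    (Icc_mem_nhds (half_lt_self hl) (lt_two_mul_self hl)))
  have hK : IsCompact (Icc (-1) A ∩ {t : ℝ | δ ≤ |t|}) :=
    isCompact_Icc.inter_right (isClosed_le continuous_const continuous_abs)
  have hpos {t : ℝ} (ht : δ ≤ |t|) : 0 < |t| ^ γ := Real.rpow_pos_of_pos (hδ.trans_le ht) γ
  obtain ⟨a, ha, b, hb, hab⟩ := hK.exists_pos_bounds
    (f := fun t => Hrel γ (1 + t) 1 / |t| ^ γ)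
    ((continuous_Hrel_one_add hγ).continuousOn.div
      ((Real.continuous_rpow_const (by linarith)).comp continuous_abs).continuousOn
      fun t ht => (hpos ht.2).ne')
    (fun t ht => div_pos
      (Hrel_one_add_pos hγ ht.1.1 (abs_pos.mp (hδ.trans_le ht.2))) (hpos ht.2))
  refine ⟨min a (1 / (γ - 1) / 2), by positivity, max b (2 * (1 / (γ - 1))), by positivity,
    fun t ht1 ht => ?_⟩
  rw [← le_div_iff₀ (hpos ht), ← div_le_iff₀ (hpos ht)]
  rcases le_total t A with h | h
  · have := hab t ⟨⟨ht1, h⟩, ht⟩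
    exact ⟨(min_le_left _ _).trans this.1, this.2.trans (le_max_left _ _)⟩
  · have := hA t h
    exact ⟨(min_le_right _ _).trans this.1, this.2.trans (le_max_right _ _)⟩

/-- Two-sided comparison of `H_γ(ρ | r)` with `|ρ - r|²` (for `|ρ - r| < 1`)
and `|ρ - r|^γ` (for `|ρ - r| ≥ 1`), uniformly for `r` in a compact `[k₁, k₂] ⊂ (0,∞)`. -/
theorem Hrel_comparison (γ k₁ k₂ : ℝ) (hγ : 1 < γ) (hk₁ : 0 < k₁) (hk : k₁ ≤ k₂) :
    ∃ c₁ > 0, ∃ c₂ > 0, ∀ ρ r : ℝ, 0 ≤ ρ → r ∈ Set.Icc k₁ k₂ →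
      (|ρ - r| < 1 →
        c₁ * |ρ - r| ^ 2 ≤ Hrel γ ρ r ∧ Hrel γ ρ r ≤ c₂ * |ρ - r| ^ 2) ∧
      (1 ≤ |ρ - r| →
        c₁ * |ρ - r| ^ γ ≤ Hrel γ ρ r ∧ Hrel γ ρ r ≤ c₂ * |ρ - r| ^ γ) := by
  obtain ⟨a, ha, b, hb, hab⟩ := Hrel_one_add_sq_bounds hγ (1 / k₁)
  obtain ⟨a', ha', b', hb', hab'⟩ :=
    Hrel_one_add_rpow_bounds hγ (one_div_pos.mpr (hk₁.trans_le hk))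
  obtain ⟨m, hm, M, hM, hmM⟩ := (isCompact_Icc (a := k₁) (b := k₂)).exists_pos_bounds
    (f := fun r => r ^ γ / r ^ 2)
    ((Real.continuous_rpow_const (by linarith)).continuousOn.div (by fun_prop)
      fun r hr => pow_ne_zero 2 (hk₁.trans_le hr.1).ne')
    (fun r hr => by have := hk₁.trans_le hr.1; positivity)
  refine ⟨min (m * a) a', by positivity, max (M * b) b', by positivity, fun ρ r hρ hr => ?_⟩
  have hr0 : 0 < r := hk₁.trans_le hr.1
  have hrγ : 0 < r ^ γ := Real.rpow_pos_of_pos hr0 γ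
  have ht1 : -1 ≤ (ρ - r) / r := by rw [le_div_iff₀ hr0]; linarith
  rw [Hrel_eq_rpow_mul hρ hr0]
  constructor
  · intro h
    have htR : (ρ - r) / r ≤ 1 / k₁ :=
      div_le_div₀ zero_le_one ((le_abs_self _).trans h.le) hk₁ hr.1
    obtain ⟨h1, h2⟩ := hab _ ⟨ht1, htR⟩
    obtain ⟨h3, h4⟩ := hmM r hr
    have e (c : ℝ) : r ^ γ * (c * ((ρ - r) / r) ^ 2) = r ^ γ / r ^ 2 * c * |ρ - r| ^ 2 := by
      rw [sq_abs]; field_simp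
    constructor
    · refine le_trans ?_ (mul_le_mul_of_nonneg_left h1 hrγ.le)
      rw [e]
      gcongr
      exact (min_le_left _ _).trans (by gcongr)
    · refine (mul_le_mul_of_nonneg_left h2 hrγ.le).trans ?_
      rw [e]
      gcongr
      exact le_trans (by gcongr) (le_max_left _ _)
  · intro h
    have hδ : 1 / k₂ ≤ |(ρ - r) / r| := by
      rw [abs_div, abs_of_pos hr0]
      exact div_le_div₀ (abs_nonneg _) h hr0 hr.2
    obtain ⟨h1, h2⟩ := hab' _ ht1 hδ
    have e (c : ℝ) : r ^ γ * (c * |(ρ - r) / r| ^ γ) = c * |ρ - r| ^ γ := by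
      rw [abs_div, abs_of_pos hr0, Real.div_rpow (abs_nonneg _) hr0.le]; field_simp
    constructor
    · refine le_trans ?_ (mul_le_mul_of_nonneg_left h1 hrγ.le)
      rw [e]
      gcongr
      exact min_le_right _ _
    · refine (mul_le_mul_of_nonneg_left h2 hrγ.le).trans ?_
      rw [e]
      gcongr
      exact le_max_right _ _
end

section
/- Let γ ≥ 2 and 0 < k₁ ≤ k₂ be real numbers. Then there exists a constant c > 0 such that for all real ρ ≥ 0 and all r ∈ [k₁, k₂] one has (ρ − r)² ≤ c·H_γ(ρ | r). -/
/-- Bernoulli's inequality applied to `t ^ γ = (t ^ 2) ^ (γ / 2)`. -/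
theorem half_mul_sub_one_sq_le_rpow {γ t : ℝ} (hγ : 2 ≤ γ) (ht : 0 ≤ t) :
    γ / 2 * (t - 1) ^ 2 ≤ t ^ γ - 1 - γ * (t - 1) := by
  have hB := one_add_mul_self_le_rpow_one_add (s := t ^ 2 - 1) (p := γ / 2)
    (by nlinarith [sq_nonneg t]) (by linarith)
  have hpow : (1 + (t ^ 2 - 1)) ^ (γ / 2) = t ^ γ := by
    rw [add_sub_cancel, ← Real.rpow_natCast, ← Real.rpow_mul ht]
    congr 1
    push_cast
    ring
  rw [hpow] at hB
  linarith

theorem half_mul_rpow_mul_sub_sq_le_Hrel {γ ρ r : ℝ} (hγ : 2 ≤ γ) (hρ : 0 ≤ ρ) (hr : 0 < r) :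
    γ / 2 * r ^ (γ - 2) * (ρ - r) ^ 2 ≤ (γ - 1) * Hrel γ ρ r := by
  have hγ1 : γ - 1 ≠ 0 := by linarith
  obtain ⟨t, ht, rfl⟩ : ∃ t, 0 ≤ t ∧ r * t = ρ := ⟨ρ / r, by positivity, by field_simp⟩
  have h2 : r ^ γ = r ^ (γ - 2) * r ^ 2 := by
    rw [← Real.rpow_add_natCast hr.ne']
    norm_num
  have h1 : r ^ (γ - 1) = r ^ (γ - 2) * r := by
    rw [← Real.rpow_add_one hr.ne']
    ring_nf
  have h := mul_le_mul_of_nonneg_left (half_mul_sub_one_sq_le_rpow hγ ht)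
    (by positivity : 0 ≤ r ^ (γ - 2) * r ^ 2)
  rw [Hrel, mul_div_cancel₀ _ hγ1, Real.mul_rpow hr.le ht, h1, h2]
  linarith

/-- For `γ ≥ 2`, the relative internal energy dominates the squared distance,
uniformly for `r` in a compact `[k₁, k₂] ⊂ (0,∞)`: `(ρ - r)² ≤ c H_γ(ρ | r)`. -/
theorem sq_le_Hrel (γ k₁ k₂ : ℝ) (hγ : 2 ≤ γ) (hk₁ : 0 < k₁) (hk : k₁ ≤ k₂) :
    ∃ c > 0, ∀ ρ r : ℝ, 0 ≤ ρ → r ∈ Set.Icc k₁ k₂ →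
      (ρ - r) ^ 2 ≤ c * Hrel γ ρ r := by
  have hk₁pow : 0 < k₁ ^ (γ - 2) := Real.rpow_pos_of_pos hk₁ _
  refine ⟨(γ - 1) / (γ / 2 * k₁ ^ (γ - 2)), div_pos (by linarith) (by positivity), ?_⟩
  rintro ρ r hρ ⟨hr, -⟩
  rw [div_mul_eq_mul_div, le_div_iff₀ (by positivity), mul_comm]
  refine le_trans ?_ (half_mul_rpow_mul_sub_sq_le_Hrel hγ hρ (hk₁.trans_le hr))
  have hmono : k₁ ^ (γ - 2) ≤ r ^ (γ - 2) :=
    Real.rpow_le_rpow hk₁.le hr (by linarith)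
  gcongr
end
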